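/- Two transition systems with observations T and T' are ε-open bisimilar (there is a span of an ε₁-bounded open morphism and an ε₂-bounded open morphism with ε₁ + ε₂ = ε) if and only if there is a span consisting of a 0-bounded open morphism and an ε-bounded open morphism between T and T'. -/

import Mathlib

open CategoryTheory

/-- A labelled transition system over the alphabet `σ`. -/
structure TS (σ : Type) where
  S : Type
  i : S
  Δ : S → σ → S → Prop

/-- A morphism of transition systems: a function on states preserving the initial
state and the transitions. -/
structure TSHom {σ : Type} (T T' : TS σ) where
  f : T.S → T'.S
  init : f T.i = T'.i
  trans : ∀ s a t, T.Δ s a t → T'.Δ (f s) a (f t)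

@[ext] lemma TSHom.ext {σ : Type} {T T' : TS σ} {g h : TSHom T T'} (w : g.f = h.f) :
    g = h := by
  cases g; cases h; cases w; rfl

/-- The identity morphism of transition systems. -/
def TSHom.id {σ : Type} (T : TS σ) : TSHom T T := ⟨_root_.id, rfl, fun _ _ _ h => h⟩

/-- Composition of morphisms of transition systems. -/
def TSHom.comp {σ : Type} {T T' T'' : TS σ} (g : TSHom T T') (h : TSHom T' T'') :
    TSHom T T'' :=
  ⟨h.f ∘ g.f, by simp [g.init, h.init], fun s a t ht => h.trans _ _ _ (g.trans _ _ _ ht)⟩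

instance {σ : Type} : Category (TS σ) where
  Hom := TSHom
  id := TSHom.id
  comp := TSHom.comp
  id_comp _ := rfl
  comp_id _ := rfl
  assoc _ _ _ := rfl

/-- The finite linear system `L(a₁⋯aₙ)` of a word `w = a₁⋯aₙ`. -/
def Lin (σ : Type) (w : List σ) : TS σ where
  S := Fin (w.length + 1)
  i := ⟨0, Nat.succ_pos _⟩
  Δ s a t := (t : ℕ) = (s : ℕ) + 1 ∧ ∃ h : (s : ℕ) < w.length, w.get ⟨s, h⟩ = a

/-- A morphism of transition systems is `Lin_Σ`-open if it has the right lifting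
property against all morphisms between finite linear systems. -/
def LinOpen {σ : Type} {T T' : TS σ} (f : T ⟶ T') : Prop :=
  ∀ (w w' : List σ) (e : Lin σ w ⟶ Lin σ w') (p : Lin σ w ⟶ T) (q' : Lin σ w' ⟶ T'),
    p ≫ f = e ≫ q' → ∃ q : Lin σ w' ⟶ T, e ≫ q = p ∧ q ≫ f = q'

/-- A state is reachable if there is a path of transitions from the initial state. -/
def Reachable {σ : Type} (T : TS σ) (s : T.S) : Prop :=
  Relation.ReflTransGen (fun x y => ∃ a, T.Δ x a y) T.i s

/-- A transition system with observations in a pseudometric space `O`. -/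
structure TSO (σ O : Type) [PseudoMetricSpace O] where
  toTS : TS σ
  ω : toTS.S → O

/-- A bounded morphism of transition systems with observations: a morphism of the
underlying transition systems which is `ε`-bounded for some `ε ≥ 0`. -/
structure TSOHom {σ O : Type} [PseudoMetricSpace O] (T T' : TSO σ O) where
  toTSHom : TSHom T.toTS T'.toTS
  bounded : ∃ ε, 0 ≤ ε ∧ ∀ s, dist (T.ω s) (T'.ω (toTSHom.f s)) ≤ ε

@[ext] lemma TSOHom.ext {σ O : Type} [PseudoMetricSpace O] {T T' : TSO σ O}
    {g h : TSOHom T T'} (w : g.toTSHom = h.toTSHom) : g = h := by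
  cases g; cases h; cases w; rfl

instance {σ O : Type} [PseudoMetricSpace O] : Category (TSO σ O) where
  Hom := TSOHom
  id T := ⟨TSHom.id T.toTS, 0, le_refl 0, fun s => le_of_eq (dist_self (T.ω s))⟩
  comp {X Y Z} g h := ⟨g.toTSHom.comp h.toTSHom, by
    obtain ⟨ε₁, hε₁, hb₁⟩ := g.bounded
    obtain ⟨ε₂, hε₂, hb₂⟩ := h.bounded
    refine ⟨ε₁ + ε₂, add_nonneg hε₁ hε₂, fun s => ?_⟩
    have htri := dist_triangle (X.ω s) (Y.ω (g.toTSHom.f s))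
      (Z.ω (h.toTSHom.f (g.toTSHom.f s)))
    exact le_trans htri (add_le_add (hb₁ s) (hb₂ (g.toTSHom.f s)))⟩
  id_comp _ := by apply TSOHom.ext; rfl
  comp_id _ := by apply TSOHom.ext; rfl
  assoc _ _ _ := by apply TSOHom.ext; rfl

/-- `f` is an `ε`-bounded morphism. -/
def EBounded {σ O : Type} [PseudoMetricSpace O] {T T' : TSO σ O} (f : T ⟶ T')
    (ε : ℝ) : Prop :=
  ∀ s, dist (T.ω s) (T'.ω ((TSOHom.toTSHom f).f s)) ≤ ε

/-- A finite linear transition system with observations. -/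
def LinO (σ O : Type) [PseudoMetricSpace O] (w : List σ)
    (ω : Fin (w.length + 1) → O) : TSO σ O :=
  ⟨Lin σ w, ω⟩

/-- A bounded morphism is `Lin_Σ𝒪`-open if it has the right lifting property
against all (bounded) morphisms between finite linear systems with observations. -/
def LinOOpen {σ O : Type} [PseudoMetricSpace O] {T T' : TSO σ O} (f : T ⟶ T') : Prop :=
  ∀ (w w' : List σ) (ω₁ : Fin (w.length + 1) → O) (ω₂ : Fin (w'.length + 1) → O)
    (e : LinO σ O w ω₁ ⟶ LinO σ O w' ω₂) (p : LinO σ O w ω₁ ⟶ T)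
    (q' : LinO σ O w' ω₂ ⟶ T'),
    p ≫ f = e ≫ q' → ∃ q : LinO σ O w' ω₂ ⟶ T, e ≫ q = p ∧ q ≫ f = q'

/-- Two functions on a finite type into a pseudometric space are at bounded distance. -/
lemma exists_dist_bound_of_finite {α O : Type} [PseudoMetricSpace O] [Finite α] (u v : α → O) :
    ∃ ε, 0 ≤ ε ∧ ∀ s, dist (u s) (v s) ≤ ε := by
  obtain ⟨M, hM⟩ := (Set.finite_range fun s => dist (u s) (v s)).bddAbove
  exact ⟨max M 0, le_max_right _ _, fun s => le_max_of_le_left (hM ⟨s, rfl⟩)⟩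

/-- A morphism of transition systems out of a finite linear system is automatically bounded. -/
def TSOHom.ofLin {σ O : Type} [PseudoMetricSpace O] {w : List σ} {ω : Fin (w.length + 1) → O}
    {T : TSO σ O} (p : Lin σ w ⟶ T.toTS) : LinO σ O w ω ⟶ T :=
  ⟨p, exists_dist_bound_of_finite (α := Fin (w.length + 1)) ω fun s => T.ω (TSHom.f p s)⟩

/-- Openness of a bounded morphism only depends on the underlying morphism of transition
systems. -/
lemma linOOpen_iff_linOpen {σ O : Type} [PseudoMetricSpace O] {T T' : TSO σ O} (f : T ⟶ T') :
    LinOOpen f ↔ LinOpen (T := T.toTS) (T' := T'.toTS) (TSOHom.toTSHom f) := by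
  constructor
  · intro h w w' e p q' hcomm
    obtain ⟨q, hq, hq'⟩ := h w w' (fun _ => T.ω T.toTS.i) (fun _ => T.ω T.toTS.i)
      (TSOHom.ofLin e) (TSOHom.ofLin p) (TSOHom.ofLin q') (TSOHom.ext hcomm)
    exact ⟨q.toTSHom, congrArg TSOHom.toTSHom hq, congrArg TSOHom.toTSHom hq'⟩
  · intro h w w' ω₁ ω₂ e p q' hcomm
    obtain ⟨q, hq, hq'⟩ := h w w' e.toTSHom p.toTSHom q'.toTSHom
      (congrArg TSOHom.toTSHom hcomm)
    exact ⟨TSOHom.ofLin q, TSOHom.ext hq, TSOHom.ext hq'⟩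

/-- `T` and `T'` are `ε`-open bisimilar (a span of an `ε₁`-bounded open morphism
and an `ε₂`-bounded open morphism with `ε₁ + ε₂ = ε`) iff there is a span of a
`0`-bounded open morphism and an `ε`-bounded open morphism. -/
theorem stmt12 {σ O : Type} [PseudoMetricSpace O] (ε : ℝ) (T T' : TSO σ O) :
    (∃ ε₁ ε₂ : ℝ, 0 ≤ ε₁ ∧ 0 ≤ ε₂ ∧ ε₁ + ε₂ = ε ∧
      ∃ (R : TSO σ O) (f : R ⟶ T) (g : R ⟶ T'),
        EBounded f ε₁ ∧ EBounded g ε₂ ∧ LinOOpen f ∧ LinOOpen g) ↔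
    (∃ (R : TSO σ O) (f : R ⟶ T) (g : R ⟶ T'),
        EBounded f 0 ∧ EBounded g ε ∧ LinOOpen f ∧ LinOOpen g) := by
  constructor
  · rintro ⟨ε₁, ε₂, h₁, h₂, rfl, R, f, g, hf, hg, hfo, hgo⟩
    have hg' : ∀ s, dist (T.ω (f.toTSHom.f s)) (T'.ω (g.toTSHom.f s)) ≤ ε₁ + ε₂ := fun s =>
      (dist_triangle_left _ _ (R.ω s)).trans (add_le_add (hf s) (hg s))
    -- The apex keeps its transitions but observes through `f`.
    let R' : TSO σ O := ⟨R.toTS, fun s => T.ω (f.toTSHom.f s)⟩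
    let f' : R' ⟶ T := ⟨f.toTSHom, 0, le_rfl, fun _ => (dist_self _).le⟩
    let g' : R' ⟶ T' := ⟨g.toTSHom, ε₁ + ε₂, add_nonneg h₁ h₂, hg'⟩
    exact ⟨R', f', g', fun _ => (dist_self _).le, hg',
      (linOOpen_iff_linOpen f').2 ((linOOpen_iff_linOpen f).1 hfo),
      (linOOpen_iff_linOpen g').2 ((linOOpen_iff_linOpen g).1 hgo)⟩
  · rintro ⟨R, f, g, hf, hg, hfo, hgo⟩
    exact ⟨0, ε, le_rfl, dist_nonneg.trans (hg R.toTS.i), zero_add ε, R, f, g, hf, hg, hfo, hgo⟩
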